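/- arXiv:2003.02747 — 3 statements merged into one kernel-verified Lean document; each statement's English description precedes it below -/
import Mathlib

section
/- Under assumption (A), one has 0 < α⁻((α⁺)⁻¹(1)) < φ(0), where φ := α⁻∘(α⁺)⁻¹∘β⁺∘(β⁻)⁻¹. -/
theorem abs_sub_lt_of_abs_hasDerivWithinAt_lt_one {f f' : ℝ → ℝ}
    (hf : ∀ t ∈ Set.Ici (0:ℝ), HasDerivWithinAt f (f' t) (Set.Ici 0) t)
    (hf' : ∃ c < (1:ℝ), ∀ t ∈ Set.Ici (0:ℝ), |f' t| ≤ c)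
    {s t : ℝ} (hs : 0 ≤ s) (hst : s < t) : |f t - f s| < t - s := by
  obtain ⟨c, hc, hb⟩ := hf'
  have h := (convex_Ici (0:ℝ)).norm_image_sub_le_of_norm_hasDerivWithin_le
    (f := f) (f' := f') (C := c) hf hb
    (Set.mem_Ici.2 hs) (Set.mem_Ici.2 (hs.trans hst.le))
  rw [Real.norm_eq_abs, Real.norm_eq_abs, abs_of_pos (sub_pos.2 hst)] at h
  nlinarith [sub_pos.2 hst]

/-- Under assumption (A), one has 0 < α⁻((α⁺)⁻¹(1)) < φ(0), where
φ := α⁻∘(α⁺)⁻¹∘β⁺∘(β⁻)⁻¹, so φ(0) = α⁻((α⁺)⁻¹(β⁺((β⁻)⁻¹(0)))). -/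
theorem stmt_5
    (α β α' β' : ℝ → ℝ)
    (hα0 : α 0 = 0) (hβ0 : β 0 = 1)
    (hαβ : ∀ t > (0:ℝ), α t < β t)
    (hαderiv : ∀ t ∈ Set.Ici (0:ℝ), HasDerivWithinAt α (α' t) (Set.Ici 0) t)
    (hβderiv : ∀ t ∈ Set.Ici (0:ℝ), HasDerivWithinAt β (β' t) (Set.Ici 0) t)
    (hα'cont : ContinuousOn α' (Set.Ici 0)) (hβ'cont : ContinuousOn β' (Set.Ici 0))
    (hα'bd : ∃ c < (1:ℝ), ∀ t ∈ Set.Ici (0:ℝ), |α' t| ≤ c)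
    (hβ'bd : ∃ c < (1:ℝ), ∀ t ∈ Set.Ici (0:ℝ), |β' t| ≤ c)
    (αpInv αmInv βpInv βmInv : ℝ → ℝ)
    (hαpInv : Set.InvOn αpInv (fun t => t + α t) (Set.Ici 0) (Set.Ici 0))
    (hαpInvMaps : Set.MapsTo αpInv (Set.Ici 0) (Set.Ici 0))
    (hαmInv : Set.InvOn αmInv (fun t => t - α t) (Set.Ici 0) (Set.Ici 0))
    (hαmInvMaps : Set.MapsTo αmInv (Set.Ici 0) (Set.Ici 0))
    (hβpInv : Set.InvOn βpInv (fun t => t + β t) (Set.Ici 0) (Set.Ici 1))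
    (hβpInvMaps : Set.MapsTo βpInv (Set.Ici 1) (Set.Ici 0))
    (hβmInv : Set.InvOn βmInv (fun t => t - β t) (Set.Ici 0) (Set.Ici (-1)))
    (hβmInvMaps : Set.MapsTo βmInv (Set.Ici (-1)) (Set.Ici 0)) :
    0 < αpInv 1 - α (αpInv 1) ∧
    αpInv 1 - α (αpInv 1) <
      αpInv (βmInv 0 + β (βmInv 0)) - α (αpInv (βmInv 0 + β (βmInv 0))) := by
  have hα {s t : ℝ} (hs : 0 ≤ s) (hst : s < t) :=
    abs_lt.1 (abs_sub_lt_of_abs_hasDerivWithinAt_lt_one hαderiv hα'bd hs hst)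
  have hβ {s t : ℝ} (hs : 0 ≤ s) (hst : s < t) :=
    abs_lt.1 (abs_sub_lt_of_abs_hasDerivWithinAt_lt_one hβderiv hβ'bd hs hst)
  have hp0 : 0 ≤ αpInv 1 := hαpInvMaps (Set.mem_Ici.2 zero_le_one)
  have hp : αpInv 1 + α (αpInv 1) = 1 := hαpInv.2 (Set.mem_Ici.2 zero_le_one)
  have hq_mem : (0:ℝ) ∈ Set.Ici (-1:ℝ) := Set.mem_Ici.2 (by norm_num)
  have hq0 : 0 ≤ βmInv 0 := hβmInvMaps hq_mem
  have hq : βmInv 0 - β (βmInv 0) = 0 := hβmInv.2 hq_mem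
  generalize αpInv 1 = p at *
  generalize βmInv 0 = q at *
  have hp_pos : 0 < p := hp0.lt_of_ne (by rintro rfl; linarith)
  have hq_pos : 0 < q := hq0.lt_of_ne (by rintro rfl; linarith)
  have hm : 1 < q + β q := by linarith [(hβ le_rfl hq_pos).1]
  have hm_mem : q + β q ∈ Set.Ici (0:ℝ) := Set.mem_Ici.2 (by linarith)
  have hr0 : 0 ≤ αpInv (q + β q) := hαpInvMaps hm_mem
  have hr : αpInv (q + β q) + α (αpInv (q + β q)) = q + β q := hαpInv.2 hm_mem
  generalize αpInv (q + β q) = r at *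
  have hpr : p < r := by
    rcases lt_trichotomy p r with h | rfl | h
    · exact h
    · linarith
    · linarith [(hα hr0 h).1]
  exact ⟨by linarith [(hα le_rfl hp_pos).2], by linarith [(hα hp0 hpr).2]⟩
end

section
/- Let a > 1, s > 0 and z ∈ ℝ with s + z > 0. Then a^i s + z > 0 for every i ≥ 0, and the sequence P_n = ∏_{i=0}^{n} (a^i s + z)^{−1} satisfies: (i) P_n · a^{n(n+1)/2} · s^{n+1} converges as n → ∞ to a strictly positive real number; (ii) lim_{n→∞} (ln P_n)/(a^n s + z) = 0. -/
open Filter Topology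

/-- Each factor `a ^ i * s + z` equals its leading term `a ^ i * s` times a relative correction. -/
lemma pow_mul_add_eq_mul_one_add {a s : ℝ} (z : ℝ) (ha : 0 < a) (hs : 0 < s) (i : ℕ) :
    a ^ i * s + z = a ^ i * s * (1 + z / s * a⁻¹ ^ i) := by
  have := pow_pos ha i
  rw [inv_pow]
  field_simp

lemma prod_range_pow_mul {a : ℝ} (s : ℝ) (n : ℕ) :
    ∏ i ∈ Finset.range (n + 1), a ^ i * s = a ^ (n * (n + 1) / 2) * s ^ (n + 1) := by
  rw [Finset.prod_mul_distrib, Finset.prod_pow_eq_pow_sum, Finset.sum_range_id]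
  simp [mul_comm]

lemma prod_inv_mul_eq_exp_neg_sum_log {a s z : ℝ} (ha : 0 < a) (hs : 0 < s)
    (hpos : ∀ i : ℕ, 0 < a ^ i * s + z) (n : ℕ) :
    (∏ i ∈ Finset.range (n + 1), (a ^ i * s + z)⁻¹) * a ^ (n * (n + 1) / 2) * s ^ (n + 1) =
      Real.exp (-∑ i ∈ Finset.range (n + 1), Real.log (1 + z / s * a⁻¹ ^ i)) := by
  rw [mul_assoc, ← prod_range_pow_mul, ← Finset.prod_mul_distrib, ← Finset.sum_neg_distrib,
    Real.exp_sum]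
  refine Finset.prod_congr rfl fun i _ => ?_
  have hp : 0 < a ^ i * s := by positivity
  have h := hpos i
  rw [pow_mul_add_eq_mul_one_add z ha hs] at h ⊢
  have h1 : 0 < 1 + z / s * a⁻¹ ^ i := pos_of_mul_pos_right h hp.le
  rw [Real.exp_neg, Real.exp_log h1, mul_inv]
  field_simp

lemma log_prod_inv_eq {a s z : ℝ} (ha : 0 < a) (hs : 0 < s)
    (hpos : ∀ i : ℕ, 0 < a ^ i * s + z) (n : ℕ) :
    Real.log (∏ i ∈ Finset.range (n + 1), (a ^ i * s + z)⁻¹) =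
      -∑ i ∈ Finset.range (n + 1), Real.log (1 + z / s * a⁻¹ ^ i)
        - (n * (n + 1) / 2 : ℝ) * Real.log a - (n + 1) * Real.log s := by
  have h := congrArg Real.log (prod_inv_mul_eq_exp_neg_sum_log ha hs hpos n)
  have hP : 0 < ∏ i ∈ Finset.range (n + 1), (a ^ i * s + z)⁻¹ :=
    Finset.prod_pos fun i _ => inv_pos.2 (hpos i)
  have hdiv : ((n * (n + 1) / 2 : ℕ) : ℝ) = n * (n + 1) / 2 := by
    rw [Nat.cast_div (Nat.even_mul_succ_self n).two_dvd (by norm_num)]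
    push_cast
    ring
  rw [Real.log_exp, Real.log_mul (by positivity) (by positivity),
    Real.log_mul (by positivity) (by positivity), Real.log_pow, Real.log_pow, hdiv] at h
  push_cast at h
  linarith

/-- Let a > 1, s > 0 and z ∈ ℝ with s + z > 0.  Then
aⁱs + z > 0 for every i ≥ 0, and P_n = ∏_{i=0}^{n} (aⁱs + z)⁻¹ satisfies
(i) P_n · a^{n(n+1)/2} · s^{n+1} converges to a strictly positive limit;
(ii) (ln P_n)/(aⁿs + z) → 0. -/
theorem stmt_15 (a s z : ℝ) (ha : 1 < a) (hs : 0 < s) (hsz : 0 < s + z) :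
    (∀ i : ℕ, 0 < a ^ i * s + z) ∧
    (∃ L > (0:ℝ), Filter.Tendsto (fun n : ℕ =>
        (∏ i ∈ Finset.range (n + 1), (a ^ i * s + z)⁻¹) *
          a ^ (n * (n + 1) / 2) * s ^ (n + 1))
      Filter.atTop (nhds L)) ∧
    Filter.Tendsto (fun n : ℕ =>
        Real.log (∏ i ∈ Finset.range (n + 1), (a ^ i * s + z)⁻¹) / (a ^ n * s + z))
      Filter.atTop (nhds 0) := by
  have ha0 : 0 < a := one_pos.trans ha
  have hpos : ∀ i : ℕ, 0 < a ^ i * s + z := fun i => by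
    nlinarith [mul_le_mul_of_nonneg_right (one_le_pow₀ ha.le : 1 ≤ a ^ i) hs.le]
  have hsum : Summable fun i : ℕ => Real.log (1 + z / s * a⁻¹ ^ i) :=
    Real.summable_log_one_add_of_summable
      ((summable_geometric_of_lt_one (by positivity) (inv_lt_one_of_one_lt₀ ha)).mul_left _)
  have hlim := (hsum.hasSum.tendsto_sum_nat.comp (tendsto_add_atTop_nat 1)).neg
  refine ⟨hpos, ⟨_, Real.exp_pos (-∑' i : ℕ, Real.log (1 + z / s * a⁻¹ ^ i)), ?_⟩, ?_⟩
  · simp_rw [prod_inv_mul_eq_exp_neg_sum_log ha0 hs hpos]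
    exact (Real.continuous_exp.tendsto _).comp hlim
  · have h0 : Tendsto (fun n : ℕ => (a ^ n)⁻¹) atTop (𝓝 0) :=
      (tendsto_pow_atTop_atTop_of_one_lt ha).inv_tendsto_atTop
    have h1 : Tendsto (fun n : ℕ => (n : ℝ) / a ^ n) atTop (𝓝 0) := by
      simpa using tendsto_pow_const_div_const_pow_of_one_lt 1 ha
    have h2 := tendsto_pow_const_div_const_pow_of_one_lt 2 ha
    have hden : Tendsto (fun n : ℕ => (s + z * (a ^ n)⁻¹)⁻¹) atTop (𝓝 s⁻¹) := by
      simpa using ((h0.const_mul z).const_add s).inv₀ (by simpa using hs.ne')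
    have key := ((((hlim.mul h0).sub ((h2.add h1).mul_const (Real.log a / 2))).sub
      ((h1.add h0).mul_const (Real.log s))).mul hden)
    simp only [mul_zero, add_zero, zero_mul, sub_zero] at key
    refine key.congr fun n => ?_
    have hp : 0 < a ^ n := pow_pos ha0 n
    have hD : a ^ n * s + z = a ^ n * (s + z * (a ^ n)⁻¹) := by field_simp
    rw [log_prod_inv_eq ha0 hs hpos, hD, div_eq_mul_inv _ (a ^ n * _), mul_inv]
    simp only [Function.comp_apply]
    ring
end

section
/- Under assumption (A), set c₁ = α⁻((α⁺)⁻¹(1)) and φ := α⁻∘(α⁺)⁻¹∘β⁺∘(β⁻)⁻¹, and assume that φ^{[n]}(τ) → ∞ as n → ∞ for every τ ∈ [0, φ(0)). Then the intervals I_n = [φ^{[n]}(0), φ^{[n]}(c₁)) for n ≥ 0 (with φ^{[0]} = id, so I_0 = [0, c₁)) and J_n = [φ^{[n−1]}(c₁), φ^{[n]}(0)) for n ≥ 1 are pairwise disjoint, consecutively ordered (φ^{[n]}(0) < φ^{[n]}(c₁) < φ^{[n+1]}(0) for all n ≥ 0), and their union is [0,∞). -/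
theorem abs_sub_lt_of_hasDerivWithinAt_bound {f f' : ℝ → ℝ}
    (hf : ∀ t ∈ Set.Ici (0:ℝ), HasDerivWithinAt f (f' t) (Set.Ici 0) t)
    (hbd : ∃ c < (1:ℝ), ∀ t ∈ Set.Ici (0:ℝ), |f' t| ≤ c)
    {x y : ℝ} (hx : 0 ≤ x) (hxy : x < y) : |f y - f x| < y - x := by
  obtain ⟨c, hc, hb⟩ := hbd
  have h := (convex_Ici (0:ℝ)).norm_image_sub_le_of_norm_hasDerivWithin_le
    (C := c) hf hb (Set.mem_Ici.2 hx) (Set.mem_Ici.2 (hx.trans hxy.le))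
  rw [Real.norm_eq_abs, Real.norm_eq_abs, abs_of_pos (sub_pos.2 hxy)] at h
  nlinarith

theorem strictMonoOn_add_of_hasDerivWithinAt_bound {f f' : ℝ → ℝ}
    (hf : ∀ t ∈ Set.Ici (0:ℝ), HasDerivWithinAt f (f' t) (Set.Ici 0) t)
    (hbd : ∃ c < (1:ℝ), ∀ t ∈ Set.Ici (0:ℝ), |f' t| ≤ c) :
    StrictMonoOn (fun t => t + f t) (Set.Ici 0) := by
  intro x hx y _ hxy
  have h := (abs_lt.1 (abs_sub_lt_of_hasDerivWithinAt_bound hf hbd hx hxy)).1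
  dsimp only
  linarith

theorem strictMonoOn_sub_of_hasDerivWithinAt_bound {f f' : ℝ → ℝ}
    (hf : ∀ t ∈ Set.Ici (0:ℝ), HasDerivWithinAt f (f' t) (Set.Ici 0) t)
    (hbd : ∃ c < (1:ℝ), ∀ t ∈ Set.Ici (0:ℝ), |f' t| ≤ c) :
    StrictMonoOn (fun t => t - f t) (Set.Ici 0) := by
  intro x hx y _ hxy
  have h := (abs_lt.1 (abs_sub_lt_of_hasDerivWithinAt_bound hf hbd hx hxy)).2
  dsimp only
  linarith

theorem StrictMonoOn.strictMonoOn_of_rightInvOn {α β : Type*} [LinearOrder α] [Preorder β]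
    {f : α → β} {g : β → α} {s : Set α} {t : Set β} (hf : StrictMonoOn f s)
    (hg : Set.MapsTo g t s) (hfg : Set.RightInvOn g f t) : StrictMonoOn g t := by
  intro x hx y hy hxy
  rw [← hf.lt_iff_lt (hg hx) (hg hy), hfg hx, hfg hy]
  exact hxy

theorem StrictMonoOn.iterate_of_mapsTo {α : Type*} [Preorder α] {f : α → α} {s : Set α}
    (hf : StrictMonoOn f s) (hs : Set.MapsTo f s s) (n : ℕ) : StrictMonoOn f^[n] s := by
  induction n with
  | zero => exact fun x _ y _ hxy => hxy
  | succ n ih =>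
    rw [Function.iterate_succ]
    exact ih.comp hf hs


/-- Under assumption (A), with c₁ = α⁻((α⁺)⁻¹(1)) and
φ := α⁻∘(α⁺)⁻¹∘β⁺∘(β⁻)⁻¹, assuming φ^[n](τ) → ∞ for every τ ∈ [0, φ(0)),
the intervals I_n = [φ^[n](0), φ^[n](c₁)) (n ≥ 0) and
J_n = [φ^[n−1](c₁), φ^[n](0)) (n ≥ 1) are consecutively ordered
(φ^[n](0) < φ^[n](c₁) < φ^[n+1](0)), pairwise disjoint, and their union
is [0,∞).  (Here K interleaves: K(2m) = I_m, K(2m+1) = J_{m+1}.) -/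
theorem stmt_19
    (α β α' β' : ℝ → ℝ)
    (hα0 : α 0 = 0) (hβ0 : β 0 = 1)
    (hαβ : ∀ t > (0:ℝ), α t < β t)
    (hαderiv : ∀ t ∈ Set.Ici (0:ℝ), HasDerivWithinAt α (α' t) (Set.Ici 0) t)
    (hβderiv : ∀ t ∈ Set.Ici (0:ℝ), HasDerivWithinAt β (β' t) (Set.Ici 0) t)
    (hα'cont : ContinuousOn α' (Set.Ici 0)) (hβ'cont : ContinuousOn β' (Set.Ici 0))
    (hα'bd : ∃ c < (1:ℝ), ∀ t ∈ Set.Ici (0:ℝ), |α' t| ≤ c)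
    (hβ'bd : ∃ c < (1:ℝ), ∀ t ∈ Set.Ici (0:ℝ), |β' t| ≤ c)
    (αpInv αmInv βpInv βmInv : ℝ → ℝ)
    (hαpInv : Set.InvOn αpInv (fun t => t + α t) (Set.Ici 0) (Set.Ici 0))
    (hαpInvMaps : Set.MapsTo αpInv (Set.Ici 0) (Set.Ici 0))
    (hαmInv : Set.InvOn αmInv (fun t => t - α t) (Set.Ici 0) (Set.Ici 0))
    (hαmInvMaps : Set.MapsTo αmInv (Set.Ici 0) (Set.Ici 0))
    (hβpInv : Set.InvOn βpInv (fun t => t + β t) (Set.Ici 0) (Set.Ici 1))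
    (hβpInvMaps : Set.MapsTo βpInv (Set.Ici 1) (Set.Ici 0))
    (hβmInv : Set.InvOn βmInv (fun t => t - β t) (Set.Ici 0) (Set.Ici (-1)))
    (hβmInvMaps : Set.MapsTo βmInv (Set.Ici (-1)) (Set.Ici 0))
    (φ : ℝ → ℝ)
    (hφ : φ = (fun t => t - α t) ∘ αpInv ∘ (fun t => t + β t) ∘ βmInv)
    (c₁ : ℝ) (hc₁ : c₁ = αpInv 1 - α (αpInv 1))
    (htend : ∀ τ ∈ Set.Ico (0:ℝ) (φ 0),
      Filter.Tendsto (fun n : ℕ => φ^[n] τ) Filter.atTop Filter.atTop)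
    (K : ℕ → Set ℝ)
    (hK : K = fun n => if n % 2 = 0
      then Set.Ico (φ^[n / 2] 0) (φ^[n / 2] c₁)
      else Set.Ico (φ^[n / 2] c₁) (φ^[n / 2 + 1] 0)) :
    (∀ n : ℕ, φ^[n] 0 < φ^[n] c₁ ∧ φ^[n] c₁ < φ^[n + 1] 0) ∧
    (∀ m n : ℕ, m ≠ n → Disjoint (K m) (K n)) ∧
    (⋃ n : ℕ, K n) = Set.Ici 0 := by
  have hαp := strictMonoOn_add_of_hasDerivWithinAt_bound hαderiv hα'bd
  have hαm := strictMonoOn_sub_of_hasDerivWithinAt_bound hαderiv hα'bd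
  have hβp := strictMonoOn_add_of_hasDerivWithinAt_bound hβderiv hβ'bd
  have hβm := strictMonoOn_sub_of_hasDerivWithinAt_bound hβderiv hβ'bd
  have hαpI := hαp.strictMonoOn_of_rightInvOn hαpInvMaps hαpInv.2
  have hβmI := hβm.strictMonoOn_of_rightInvOn hβmInvMaps hβmInv.2
  have hsub : Set.Ici (0:ℝ) ⊆ Set.Ici (-1) := Set.Ici_subset_Ici.2 (by norm_num)
  have hβpMaps : Set.MapsTo (fun t => t + β t) (Set.Ici 0) (Set.Ici 0) := by
    intro t ht
    have h := hβp.monotoneOn Set.self_mem_Ici ht ht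
    simp only [hβ0, Set.mem_Ici] at h ⊢
    linarith
  have hαmMaps : Set.MapsTo (fun t => t - α t) (Set.Ici 0) (Set.Ici 0) := by
    intro t ht
    have h := hαm.monotoneOn Set.self_mem_Ici ht ht
    simp only [hα0, Set.mem_Ici] at h ⊢
    linarith
  have hφmaps : Set.MapsTo φ (Set.Ici 0) (Set.Ici 0) := by
    rw [hφ]
    exact hαmMaps.comp (hαpInvMaps.comp (hβpMaps.comp (hβmInvMaps.mono_left hsub)))
  have hαmI : StrictMonoOn ((fun t => t - α t) ∘ αpInv) (Set.Ici 0) :=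
    hαm.comp hαpI hαpInvMaps
  have hφmono : StrictMonoOn φ (Set.Ici 0) := by
    rw [hφ]
    exact hαm.comp (hαpI.comp (hβp.comp (hβmI.mono hsub) (hβmInvMaps.mono_left hsub))
      (hβpMaps.comp (hβmInvMaps.mono_left hsub)))
      (hαpInvMaps.comp (hβpMaps.comp (hβmInvMaps.mono_left hsub)))
  have hαpI0 : αpInv 0 = 0 := by
    simpa [hα0] using hαpInv.1 (Set.self_mem_Ici (a := (0:ℝ)))
  have hβmI1 : βmInv (-1) = 0 := by
    simpa [hβ0] using hβmInv.1 (Set.self_mem_Ici (a := (0:ℝ)))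
  have hc₁pos : 0 < c₁ := by
    have h := hαmI Set.self_mem_Ici (Set.mem_Ici.2 zero_le_one) zero_lt_one
    simpa [hαpI0, hα0, ← hc₁] using h
  have hc₁φ : c₁ < φ 0 := by
    have h0 : 0 < βmInv 0 := by
      have h := hβmI Set.self_mem_Ici (hsub Set.self_mem_Ici) (neg_one_lt_zero (R := ℝ))
      rwa [hβmI1] at h
    have h1 : 1 < βmInv 0 + β (βmInv 0) := by
      simpa [hβ0] using hβp Set.self_mem_Ici (Set.mem_Ici.2 h0.le) h0
    have h := hαmI (Set.mem_Ici.2 zero_le_one) (Set.mem_Ici.2 (zero_le_one.trans h1.le)) h1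
    rw [hc₁, hφ]
    exact h
  have horder : ∀ n : ℕ, φ^[n] 0 < φ^[n] c₁ ∧ φ^[n] c₁ < φ^[n + 1] 0 := fun n => by
    have hn := hφmono.iterate_of_mapsTo hφmaps n
    exact ⟨hn Set.self_mem_Ici hc₁pos.le hc₁pos,
      hn hc₁pos.le (hc₁pos.trans hc₁φ).le hc₁φ⟩
  let a : ℕ → ℝ := fun n => if n % 2 = 0 then φ^[n / 2] 0 else φ^[n / 2] c₁
  have ha0 : ∀ m, a (2 * m) = φ^[m] 0 := fun m => by simp [a]
  have ha1 : ∀ m, a (2 * m + 1) = φ^[m] c₁ := fun m => by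
    simp [a, Nat.add_mod, show (2 * m + 1) / 2 = m by omega]
  have hKa : ∀ n, K n = Set.Ico (a n) (a (n + 1)) := fun n => by
    rcases Nat.even_or_odd' n with ⟨m, rfl | rfl⟩
    · rw [ha0, ha1, hK]
      simp
    · rw [ha1, show 2 * m + 1 + 1 = 2 * (m + 1) by ring, ha0, hK]
      simp [Nat.add_mod, show (2 * m + 1) / 2 = m by omega]
  have hamono : Monotone a := monotone_nat_of_le_succ fun n => by
    rcases Nat.even_or_odd' n with ⟨m, rfl | rfl⟩
    · rw [ha0, ha1]
      exact (horder m).1.le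
    · rw [ha1, show 2 * m + 1 + 1 = 2 * (m + 1) by ring, ha0]
      exact (horder m).2.le
  have hunbdd : ¬ BddAbove (Set.range a) := by
    rintro ⟨B, hB⟩
    obtain ⟨m, hm⟩ := ((htend 0 ⟨le_rfl, hc₁pos.trans hc₁φ⟩).eventually_gt_atTop B).exists
    exact (hB ⟨2 * m, ha0 m⟩).not_gt hm
  refine ⟨horder, fun m n hmn => ?_, ?_⟩
  · rw [hKa, hKa]
    exact hamono.pairwise_disjoint_on_Ico_succ hmn
  · simp only [hKa]
    exact (iUnion_Ico_map_succ_eq_Ici (fun n => hamono (Nat.zero_le n)) hunbdd).trans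
      (congrArg Set.Ici (ha0 0))
end
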